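/- arXiv:1911.02957 — 14 statements merged into one kernel-verified Lean document; each statement's English description precedes it below -/
import Mathlib

section
/- Let e ≥ 1 be an integer and let M be a ℤ-module on which multiplication by e is injective. Let R = ℤ[ζ_e] be the subring of the e-th cyclotomic field generated over ℤ by a primitive e-th root of unity, and let N = M ⊗_ℤ R. Every ring automorphism σ of R acts ℤ-linearly on N via id_M ⊗ σ. Then the canonical map ι : M → N, m ↦ m ⊗ 1, is injective, and the image of ι is exactly the set of elements of N that are fixed by id_M ⊗ σ for every ring automorphism σ of R. -/
open scoped TensorProduct

set_option synthInstance.maxHeartbeats 1000000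
set_option maxHeartbeats 2000000

/-- If `ζ` is a primitive `n`-th root of unity in the cyclotomic field `K`, then `Φₙ'(ζ)`
divides `n` in `ℤ[ζ]`, so Euler's formula for the trace dual of the power basis of `ζ`
gives an element of `ℤ[ζ]` of trace `n`. -/
theorem IsPrimitiveRoot.exists_mem_adjoin_trace_eq {n : ℕ} [NeZero n] {K : Type*} [Field K]
    [CharZero K] [IsCyclotomicExtension {n} ℚ K] {ζ : K} (hζ : IsPrimitiveRoot ζ n) :
    ∃ a ∈ Algebra.adjoin ℤ ({ζ} : Set K), Algebra.trace ℚ K a = n := by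
  have hint : IsIntegral ℤ ζ := hζ.isIntegral (NeZero.pos n)
  have : FiniteDimensional ℚ K := IsCyclotomicExtension.finiteDimensional {n} ℚ K
  obtain ⟨g, hg⟩ : minpoly ℤ ζ ∣ Polynomial.X ^ n - 1 :=
    minpoly.isIntegrallyClosed_dvd hint (by simp [hζ.pow_eq_one])
  have hder : (n : K) * ζ ^ (n - 1) =
      Polynomial.aeval ζ (Polynomial.derivative (minpoly ℚ ζ)) * Polynomial.aeval ζ g := by
    have h := congrArg (fun p ↦ Polynomial.aeval ζ (Polynomial.derivative p)) hg
    simp only [Polynomial.derivative_mul, map_add, map_mul, minpoly.aeval, zero_mul, add_zero,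
      Polynomial.derivative_sub, Polynomial.derivative_X_pow, Polynomial.derivative_one, sub_zero,
      Polynomial.aeval_X, map_pow] at h
    rw [minpoly.isIntegrallyClosed_eq_field_fractions' ℚ hint, Polynomial.derivative_map,
      Polynomial.aeval_map_algebraMap, ← h]
    simp
  have hd : Polynomial.aeval ζ (Polynomial.derivative (minpoly ℚ ζ)) ≠ 0 :=
    (Algebra.IsSeparable.isSeparable ℚ ζ).aeval_derivative_ne_zero (minpoly.aeval _ _)
  let pb := hζ.powerBasis ℚ
  let i : Fin pb.dim := ⟨0, pb.dim_pos⟩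
  have htr : Algebra.trace ℚ K (pb.basis.traceDual i) = 1 := by
    have h := pb.basis.trace_traceDual_mul i i
    simpa [i] using h
  rw [Module.Basis.traceDual_powerBasis_eq] at htr
  have hgen : pb.gen = ζ := hζ.powerBasis_gen ℚ
  rw [hgen] at htr
  have hself := Algebra.self_mem_adjoin_singleton ℤ ζ
  refine ⟨(minpolyDiv ℤ ζ).coeff i * (ζ * Polynomial.aeval ζ g),
    mul_mem (coeff_minpolyDiv_mem_adjoin ζ i)
      (mul_mem hself (Polynomial.aeval_mem_adjoin_singleton ℤ ζ)), ?_⟩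
  have heq : (minpolyDiv ℤ ζ).coeff i * (ζ * Polynomial.aeval ζ g) =
      (n : ℚ) • ((minpolyDiv ℚ ζ).coeff i /
        Polynomial.aeval ζ (Polynomial.derivative (minpoly ℚ ζ))) := by
    have hpow : ζ * ζ ^ (n - 1) = 1 := by
      rw [← pow_succ', Nat.sub_add_cancel (NeZero.pos n), hζ.pow_eq_one]
    rw [minpolyDiv_eq_of_isIntegrallyClosed ℚ hint, Algebra.smul_def, map_natCast]
    field_simp
    linear_combination (-(minpolyDiv ℚ ζ).coeff i * ζ) * hder +
      (minpolyDiv ℚ ζ).coeff i * n * hpow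
  rw [heq, map_smul, htr, smul_eq_mul, mul_one]

/-- The ring `ℤ[ζ]` has a `ℤ`-linear retraction onto `ℤ`. -/
theorem IsIntegral.exists_adjoin_toInt_apply_one {K : Type*} [Field K] [CharZero K] {ζ : K}
    (hζ : IsIntegral ℤ ζ) :
    ∃ s : Algebra.adjoin ℤ ({ζ} : Set K) →ₗ[ℤ] ℤ, s 1 = 1 := by
  let pb := Algebra.adjoin.powerBasis' hζ
  let i : Fin pb.dim := ⟨0, pb.dim_pos⟩
  refine ⟨pb.basis.coord i, ?_⟩
  have h : pb.basis i = 1 := by simp [i]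
  rw [← h, Module.Basis.coord_apply, Module.Basis.repr_self, Finsupp.single_eq_same]

/-- An element `a` of `ℤ[ζ]` and finitely many ring automorphisms of `ℤ[ζ]` such that summing over
these automorphisms takes integer values, and takes the value `n` at `a`. -/
theorem IsPrimitiveRoot.exists_sum_ringEquiv_adjoin.{u} {n : ℕ} [NeZero n] {K : Type u}
    [Field K] [CharZero K] [IsCyclotomicExtension {n} ℚ K] {ζ : K} (hζ : IsPrimitiveRoot ζ n) :
    ∃ (G : Type u) (_ : Fintype G)
      (ρ : G → (Algebra.adjoin ℤ ({ζ} : Set K) ≃+* Algebra.adjoin ℤ ({ζ} : Set K)))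
      (a : Algebra.adjoin ℤ ({ζ} : Set K)),
      (∀ r, ∃ k : ℤ, ∑ g, ρ g r = k) ∧ ∑ g, ρ g a = n := by
  have : FiniteDimensional ℚ K := IsCyclotomicExtension.finiteDimensional {n} ℚ K
  have : IsGalois ℚ K := IsCyclotomicExtension.isGalois {n} ℚ K
  have : IsIntegralClosure (Algebra.adjoin ℤ ({ζ} : Set K)) ℤ K :=
    IsCyclotomicExtension.Rat.isIntegralClosure_adjoin_singleton hζ
  let ρ (g : Gal(K/ℚ)) : Algebra.adjoin ℤ ({ζ} : Set K) ≃+* Algebra.adjoin ℤ ({ζ} : Set K) :=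
    (galRestrict ℤ ℚ K (Algebra.adjoin ℤ ({ζ} : Set K)) g).toRingEquiv
  have hρ (r : Algebra.adjoin ℤ ({ζ} : Set K)) :
      ((∑ g, ρ g r : Algebra.adjoin ℤ ({ζ} : Set K)) : K) =
        algebraMap ℚ K (Algebra.trace ℚ K r) := by
    rw [trace_eq_sum_automorphisms, AddSubmonoidClass.coe_finsetSum]
    exact Finset.sum_congr rfl fun g _ ↦
      algebraMap_galRestrict_apply ℤ (K := ℚ) (L := K) g r
  obtain ⟨a, ha, htr⟩ := hζ.exists_mem_adjoin_trace_eq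
  refine ⟨Gal(K/ℚ), inferInstance, ρ, ⟨a, ha⟩, fun r ↦ ?_, Subtype.ext ?_⟩
  · have hr : IsIntegral ℤ (r : K) := IsIntegralClosure.isIntegral_iff.2 ⟨r, rfl⟩
    obtain ⟨k, hk⟩ := IsIntegrallyClosed.isIntegral_iff.1
      (Algebra.isIntegral_trace (L := ℚ) hr)
    refine ⟨k, Subtype.ext ?_⟩
    rw [hρ, ← hk]
    simp
  · rw [hρ, htr]
    simp

/-- Descent along `M → M ⊗ R`, where `R` is a flat `A`-algebra with an `A`-linear retraction onto
`A` and a finite family of multiplicative `A`-linear endomorphisms whose sum maps `R` to `A` and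
takes a value `n` in `A` that acts injectively on `M`: invariant elements come from `M`. -/
theorem TensorProduct.exists_tmul_one_eq_of_forall_lTensor_eq {A M R : Type*} [CommRing A]
    [AddCommGroup M] [Module A M] [CommRing R] [Algebra A R] [Module.Flat A R] {n : A}
    (hM : Function.Injective fun m : M ↦ n • m) (s : R →ₗ[A] A) (hs : s 1 = 1)
    {G : Type*} [Fintype G] (ρ : G → R →ₗ[A] R) (hρmul : ∀ g b c, ρ g (b * c) = ρ g b * ρ g c)
    (hρ : ∀ r, ∃ k : A, ∑ g, ρ g r = algebraMap A R k) {a : R} (ha : ∑ g, ρ g a = algebraMap A R n)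
    {x : M ⊗[A] R} (hx : ∀ g, LinearMap.lTensor M (ρ g) x = x) :
    ∃ m : M, m ⊗ₜ[A] (1 : R) = x := by
  have hN : Function.Injective fun x : M ⊗[A] R ↦ n • x := by
    have h := Module.Flat.rTensor_preserves_injective_linearMap (M := R)
      (LinearMap.lsmul A M n) hM
    have heq : LinearMap.rTensor R (LinearMap.lsmul A M n) = LinearMap.lsmul A (M ⊗[A] R) n := by
      ext
      simp [TensorProduct.smul_tmul']
    rw [heq] at h
    exact h
  have hsum (y : M ⊗[A] R) : ∃ m : M, ∑ g, LinearMap.lTensor M (ρ g) y = m ⊗ₜ[A] (1 : R) := by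
    induction y with
    | zero => exact ⟨0, by simp⟩
    | tmul m r =>
      obtain ⟨k, hk⟩ := hρ r
      refine ⟨k • m, ?_⟩
      simp only [LinearMap.lTensor_tmul, ← TensorProduct.tmul_sum]
      rw [TensorProduct.smul_tmul, ← Algebra.algebraMap_eq_smul_one, hk]
    | add y z hy hz =>
      obtain ⟨p, hp⟩ := hy
      obtain ⟨q, hq⟩ := hz
      exact ⟨p + q, by simp only [map_add, Finset.sum_add_distrib, hp, hq, TensorProduct.add_tmul]⟩
  have hmul (g : G) (y : M ⊗[A] R) :
      LinearMap.lTensor M (ρ g) (LinearMap.lTensor M (LinearMap.mulLeft A a) y) =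
        LinearMap.lTensor M (LinearMap.mulLeft A (ρ g a)) (LinearMap.lTensor M (ρ g) y) := by
    induction y with
    | zero => simp
    | tmul m r => simp [hρmul]
    | add y z hy hz => simp only [map_add, hy, hz]
  have hmulsum (y : M ⊗[A] R) :
      ∑ g, LinearMap.lTensor M (LinearMap.mulLeft A (ρ g a)) y = n • y := by
    induction y with
    | zero => simp
    | tmul m r =>
      simp only [LinearMap.lTensor_tmul, LinearMap.mulLeft_apply, ← TensorProduct.tmul_sum,
        ← Finset.sum_mul, ha]
      rw [← _root_.Algebra.smul_def, TensorProduct.tmul_smul]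
    | add y z hy hz => simp only [map_add, Finset.sum_add_distrib, hy, hz, smul_add]
  obtain ⟨m, hm⟩ := hsum (LinearMap.lTensor M (LinearMap.mulLeft A a) x)
  have hnx : n • x = m ⊗ₜ[A] (1 : R) := by
    simp only [← hm, ← hmulsum x, hmul, hx]
  let retr : M ⊗[A] R →ₗ[A] M := (TensorProduct.rid A M).toLinearMap ∘ₗ LinearMap.lTensor M s
  have hretr : n • retr x = m := by
    rw [← map_smul, hnx]
    simp [retr, hs]
  refine ⟨retr x, hN ?_⟩
  simp only
  rw [hnx, TensorProduct.smul_tmul', hretr]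

/-- The map `M → M ⊗ R` is injective if `R` has an `A`-linear retraction onto `A`. -/
theorem TensorProduct.tmul_one_injective {A M R : Type*} [CommRing A]
    [AddCommGroup M] [Module A M] [CommRing R] [Algebra A R] (s : R →ₗ[A] A) (hs : s 1 = 1) :
    Function.Injective fun m : M ↦ m ⊗ₜ[A] (1 : R) := by
  intro p q h
  simpa [hs] using congrArg (fun x ↦ TensorProduct.rid A M (LinearMap.lTensor M s x)) h

/-- Let `e ≥ 1` and let `M` be a `ℤ`-module on which multiplication by `e` is
injective. Let `R = ℤ[ζ_e] = Algebra.adjoin ℤ {ζ}` inside the `e`-th cyclotomic field and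
`N = M ⊗[ℤ] R`.  Every ring automorphism `σ` of `R` acts on `N` as `id_M ⊗ σ`.  Then the
canonical map `ι : M → N`, `m ↦ m ⊗ 1`, is injective, and its range is exactly the set of
elements of `N` fixed by `id_M ⊗ σ` for every ring automorphism `σ` of `R`. -/
theorem stmt4 (e : ℕ+) (ζ : CyclotomicField e ℚ) (hζ : IsPrimitiveRoot ζ (e : ℕ))
    (M : Type*) [AddCommGroup M] [Module ℤ M]
    (hM : Function.Injective fun m : M => (e : ℤ) • m) :
    Function.Injective
        (fun m : M => m ⊗ₜ[ℤ] (1 : Algebra.adjoin ℤ ({ζ} : Set (CyclotomicField e ℚ)))) ∧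
      Set.range
          (fun m : M =>
            m ⊗ₜ[ℤ] (1 : Algebra.adjoin ℤ ({ζ} : Set (CyclotomicField e ℚ)))) =
        {x : M ⊗[ℤ] (Algebra.adjoin ℤ ({ζ} : Set (CyclotomicField e ℚ))) |
          ∀ σ : (Algebra.adjoin ℤ ({ζ} : Set (CyclotomicField e ℚ))) ≃+*
              (Algebra.adjoin ℤ ({ζ} : Set (CyclotomicField e ℚ))),
            LinearMap.lTensor M σ.toRingHom.toAddMonoidHom.toIntLinearMap x = x} := by
  have : NeZero (e : ℕ) := ⟨e.pos.ne'⟩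
  have : IsCyclotomicExtension {(e : ℕ)} ℚ (CyclotomicField e ℚ) :=
    CyclotomicField.isCyclotomicExtension e ℚ
  obtain ⟨s, hs⟩ := (hζ.isIntegral e.pos).exists_adjoin_toInt_apply_one
  obtain ⟨G, _, ρ, a, hρ, ha⟩ := hζ.exists_sum_ringEquiv_adjoin
  refine ⟨TensorProduct.tmul_one_injective s hs,
    Set.Subset.antisymm (Set.range_subset_iff.2 fun m σ ↦ ?_) fun x hx ↦ ?_⟩
  · exact (LinearMap.lTensor_tmul M _ m 1).trans (congrArg (m ⊗ₜ[ℤ] ·) (map_one σ))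
  · have hM' : Function.Injective fun m : M ↦
        SMul.smul (self := ‹Module ℤ M›.toSMul) (e : ℤ) m := by
      simpa only [int_smul_eq_zsmul] using hM
    exact TensorProduct.exists_tmul_one_eq_of_forall_lTensor_eq hM' s hs
      (fun g ↦ (ρ g).toRingHom.toAddMonoidHom.toIntLinearMap) (fun g ↦ map_mul (ρ g)) hρ
      (a := a) (ha.trans (Int.cast_natCast _).symm) fun g ↦ hx (ρ g)
end

section
/- Let k be a commutative ring, M a k-module, and f, g k-linear endomorphisms of M. Suppose f is S-diagonalizable and g is T-diagonalizable for subsets S, T ⊆ k. Then f and g commute if and only if M is the internal direct sum of the family of submodules M(f,λ) ∩ M(g,μ) indexed by pairs (λ, μ) ∈ S × T. -/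
theorem iSupIndep.inf_prod {ι κ α : Type*} [CompleteLattice α] [IsModularLattice α]
    [IsCompactlyGenerated α] {a : ι → α} {b : κ → α} (ha : iSupIndep a) (hb : iSupIndep b) :
    iSupIndep fun p : ι × κ => a p.1 ⊓ b p.2 := by
  classical
  refine iSupIndep_iff_supIndep.mpr fun s => ?_
  refine Finset.SupIndep.subset (t := s.image Prod.fst ×ˢ s.image Prod.snd) ?_
    Finset.subset_product
  exact Finset.SupIndep.product
    ((ha.supIndep' _).mono fun i _ => Finset.sup_le fun _ _ => inf_le_left)
    ((hb.supIndep' _).mono fun j _ => Finset.sup_le fun _ _ => inf_le_right)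

namespace Module.End

variable {k M ι : Type*} [CommRing k] [AddCommGroup M] [Module k M]

theorem eigenspace_le_iSup_inf_of_mapsTo {p : ι → Submodule k M} (hp : iSupIndep p)
    (hp' : ⨆ i, p i = ⊤) {g : End k M} (hg : ∀ i, ∀ x ∈ p i, g x ∈ p i) (μ : k) :
    g.eigenspace μ ≤ ⨆ i, p i ⊓ g.eigenspace μ := by
  intro x hx
  obtain ⟨v, hv, rfl⟩ :=
    (Submodule.mem_iSup_iff_exists_finsupp p x).mp (hp' ▸ Submodule.mem_top)
  have hsum : ∑ i ∈ v.support, g (v i) = ∑ i ∈ v.support, μ • v i := by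
    simpa [Finsupp.sum, Finset.smul_sum] using mem_eigenspace_iff.mp hx
  have heq := (iSupIndep_iff_finsetSum_eq_imp_eq p).mp hp v.support _ _
    (fun i _ => ⟨hg i _ (hv i), (p i).smul_mem μ (hv i)⟩) hsum
  exact Submodule.sum_mem _ fun i hi =>
    Submodule.mem_iSup_of_mem i ⟨hv i, mem_eigenspace_iff.mpr (heq i hi)⟩

theorem commute_of_iSup_inf_eigenspace_eq_top {f g : End k M} {a b : ι → k}
    (h : ⨆ i, f.eigenspace (a i) ⊓ g.eigenspace (b i) = ⊤) : Commute f g := by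
  have hle : ⨆ i, f.eigenspace (a i) ⊓ g.eigenspace (b i) ≤ LinearMap.eqLocus (f * g) (g * f) := by
    refine iSup_le fun i x hx => ?_
    have hf := mem_eigenspace_iff.mp hx.1
    have hg := mem_eigenspace_iff.mp hx.2
    simp [LinearMap.mem_eqLocus, hf, hg, smul_comm (a i)]
  exact LinearMap.ext fun x => hle (h ▸ Submodule.mem_top)

end Module.End

/-- Let `k` be a commutative ring, `M` a `k`-module and `f g` `k`-linear
endomorphisms of `M`.  Suppose `f` is `S`-diagonalizable and `g` is `T`-diagonalizable for
subsets `S T ⊆ k` (i.e. the families of eigenspaces are independent with supremum `⊤`).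
Then `f` and `g` commute iff `M` is the internal direct sum of the submodules
`M(f,λ) ⊓ M(g,μ)` for `(λ, μ) ∈ S × T`. -/
theorem stmt5 {k : Type*} [CommRing k] {M : Type*} [AddCommGroup M] [Module k M]
    (f g : M →ₗ[k] M) (S T : Set k)
    (hfS : iSupIndep (fun l : S => Module.End.eigenspace f l) ∧
      (⨆ l : S, Module.End.eigenspace f l) = ⊤)
    (hgT : iSupIndep (fun m : T => Module.End.eigenspace g m) ∧
      (⨆ m : T, Module.End.eigenspace g m) = ⊤) :
    Commute f g ↔
      iSupIndep (fun p : S × T =>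
          Module.End.eigenspace f p.1 ⊓ Module.End.eigenspace g p.2) ∧
        (⨆ p : S × T, Module.End.eigenspace f p.1 ⊓ Module.End.eigenspace g p.2) = ⊤ := by
  refine ⟨fun h => ⟨hfS.1.inf_prod hgT.1, ?_⟩,
    fun h => Module.End.commute_of_iSup_inf_eigenspace_eq_top h.2⟩
  rw [iSup_prod, iSup_comm, eq_top_iff, ← hgT.2]
  exact iSup_mono fun m => Module.End.eigenspace_le_iSup_inf_of_mapsTo hfS.1 hfS.2
    (fun l => Module.End.mapsTo_genEigenspace_of_comm h l 1) m
end

section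
/- Let k be a commutative ring, M a k-module, and f, g commuting k-linear endomorphisms of M with f S-diagonalizable and g T-diagonalizable for subsets S, T ⊆ k. Let U = {λ·μ | λ ∈ S, μ ∈ T}. If for all distinct ν, ν′ ∈ U the map x ↦ (ν − ν′)·x is injective on M, then the composite f ∘ g is U-diagonalizable. -/
open Module.End in
/-- Eigenspaces are independent as soon as the differences of distinct eigenvalues act
injectively on the module. -/
theorem iSupIndep_eigenspace_of_injective_sub_smul {k M : Type*} [CommRing k] [AddCommGroup M]
    [Module k M] (h : Module.End k M) (U : Set k)
    (hU : ∀ u ∈ U, ∀ v ∈ U, u ≠ v → Function.Injective fun x : M => (u - v) • x) :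
    iSupIndep (fun u : U => eigenspace h u) := by
  classical
  rw [iSupIndep_iff_finsetSum_eq_zero_imp_eq_zero]
  intro s
  induction s using Finset.induction_on with
  | empty => simp
  | insert a s ha ih =>
    intro v hv hsum
    have hv' : ∀ i ∈ insert a s, h (v i) = (i : k) • v i := fun i hi =>
      mem_eigenspace_iff.mp (hv i hi)
    rw [Finset.sum_insert ha] at hsum
    have key : ∑ i ∈ s, ((i : k) - a) • v i = 0 := by
      have h₁ : (h - algebraMap k (Module.End k M) a) (v a + ∑ i ∈ s, v i) = 0 := by
        rw [hsum, map_zero]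
      rw [map_add, map_sum] at h₁
      simp only [LinearMap.sub_apply, Module.algebraMap_end_apply,
        hv' a (Finset.mem_insert_self a s), sub_self, zero_add] at h₁
      rw [← h₁]
      exact Finset.sum_congr rfl fun i hi => by
        rw [hv' i (Finset.mem_insert_of_mem hi), sub_smul]
    have hs : ∀ i ∈ s, v i = 0 := by
      intro i hi
      have h₂ := ih (fun i => ((i : k) - a) • v i)
        (fun i hi => Submodule.smul_mem _ _ (hv i (Finset.mem_insert_of_mem hi))) key i hi
      have hia : (i : k) ≠ a := fun e => ha (Subtype.ext e ▸ hi)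
      exact hU i i.2 a a.2 hia (by simpa using h₂)
    rw [Finset.sum_eq_zero hs, add_zero] at hsum
    intro i hi
    rcases Finset.mem_insert.mp hi with rfl | hi
    · exact hsum
    · exact hs i hi

open Module.End in
/-- If the eigenspaces of `f` are independent and span, then every eigenspace of an endomorphism
commuting with `f` is covered by its intersections with the eigenspaces of `f`. -/
theorem eigenspace_le_iSup_inf_eigenspace {k M : Type*} [CommRing k] [AddCommGroup M]
    [Module k M] {f g : Module.End k M} (hfg : Commute f g) (S : Set k)
    (hind : iSupIndep (fun l : S => eigenspace f l)) (htop : (⨆ l : S, eigenspace f l) = ⊤)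
    (m : k) : eigenspace g m ≤ ⨆ l : S, eigenspace f l ⊓ eigenspace g m := by
  intro x hx
  rw [mem_eigenspace_iff] at hx
  obtain ⟨c, hc, rfl⟩ := (Submodule.mem_iSup_iff_exists_finsupp _ x).mp
    (htop ▸ Submodule.mem_top : x ∈ ⨆ l : S, eigenspace f l)
  rw [iSupIndep_iff_finsetSum_eq_zero_imp_eq_zero] at hind
  have hz := hind c.support (fun i => g (c i) - m • c i)
    (fun i _ => Submodule.sub_mem _
      (mapsTo_genEigenspace_of_comm hfg i 1 (hc i)) (Submodule.smul_mem _ _ (hc i)))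
    (by simpa [Finsupp.sum, Finset.sum_sub_distrib, Finset.smul_sum, sub_eq_zero] using hx)
  exact Submodule.sum_mem _ fun i hi => Submodule.mem_iSup_of_mem i
    ⟨hc i, mem_eigenspace_iff.mpr (sub_eq_zero.mp (hz i hi))⟩

/-- Let `k` be a commutative ring, `M` a `k`-module, and `f g` commuting
`k`-linear endomorphisms of `M` with `f` `S`-diagonalizable and `g` `T`-diagonalizable.
Let `U = {λ * μ | λ ∈ S, μ ∈ T}`.  If for all distinct `ν ν' ∈ U` multiplication by `ν - ν'`
is injective on `M`, then `f ∘ g` is `U`-diagonalizable. -/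
theorem stmt7 {k : Type*} [CommRing k] {M : Type*} [AddCommGroup M] [Module k M]
    (f g : M →ₗ[k] M) (hfg : Commute f g) (S T : Set k)
    (hfS : iSupIndep (fun l : S => Module.End.eigenspace f l) ∧
      (⨆ l : S, Module.End.eigenspace f l) = ⊤)
    (hgT : iSupIndep (fun m : T => Module.End.eigenspace g m) ∧
      (⨆ m : T, Module.End.eigenspace g m) = ⊤)
    (hU : ∀ u ∈ Set.image2 (· * ·) S T, ∀ v ∈ Set.image2 (· * ·) S T, u ≠ v →
      Function.Injective fun x : M => (u - v) • x) :
    iSupIndep (fun u : Set.image2 (· * ·) S T => Module.End.eigenspace (f ∘ₗ g) u) ∧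
      (⨆ u : Set.image2 (· * ·) S T, Module.End.eigenspace (f ∘ₗ g) u) = ⊤ := by
  refine ⟨iSupIndep_eigenspace_of_injective_sub_smul _ _ hU, ?_⟩
  rw [eq_top_iff, ← hgT.2]
  refine iSup_le fun m => (eigenspace_le_iSup_inf_eigenspace hfg S hfS.1 hfS.2 m).trans
    (iSup_le fun l => ?_)
  rintro x ⟨hxf, hxg⟩
  refine Submodule.mem_iSup_of_mem ⟨l * m, Set.mem_image2_of_mem l.2 m.2⟩ ?_
  have hxf' : f x = (l : k) • x := Module.End.mem_eigenspace_iff.mp hxf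
  have hxg' : g x = (m : k) • x := Module.End.mem_eigenspace_iff.mp hxg
  rw [Module.End.mem_eigenspace_iff, LinearMap.comp_apply, hxg', map_smul, hxf', smul_smul,
    mul_comm]
end

section
/- Let R be a commutative ring. If R has only finitely many minimal prime ideals, then R has only finitely many idempotent elements; that is, the set {e ∈ R | e² = e} is finite. -/
theorem IsIdempotentElem.one_sub_mem_of_notMem {R : Type*} [CommRing R] {e : R}
    (he : IsIdempotentElem e) {p : Ideal R} (hp : p.IsPrime) (h : e ∉ p) : 1 - e ∈ p :=
  (hp.mem_or_mem (by rw [he.mul_one_sub_self]; exact p.zero_mem)).resolve_left h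

/-- An idempotent is determined by the set of minimal primes containing it. -/
theorem IsIdempotentElem.injOn_minimalPrimes (R : Type*) [CommRing R] :
    Set.InjOn (fun e : R ↦ {p ∈ minimalPrimes R | e ∈ p}) {e : R | IsIdempotentElem e} := by
  intro e he f hf hef
  refine eq_of_isNilpotent_sub_of_isIdempotentElem he hf ?_
  rw [← mem_nilradical, nilradical, Ideal.zero_eq_bot,
    ← Ideal.sInf_minimalPrimes, Ideal.mem_sInf]
  intro p hp
  have hiff : e ∈ p ↔ f ∈ p := by
    have := Set.ext_iff.mp hef p
    exact ⟨fun h ↦ (this.mp ⟨hp, h⟩).2, fun h ↦ (this.mpr ⟨hp, h⟩).2⟩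
  have hprime : p.IsPrime := hp.1.1
  by_cases h : e ∈ p
  · exact p.sub_mem h (hiff.mp h)
  · have hsub := p.sub_mem (IsIdempotentElem.one_sub_mem_of_notMem hf hprime (mt hiff.mpr h))
      (IsIdempotentElem.one_sub_mem_of_notMem he hprime h)
    rwa [sub_sub_sub_cancel_left] at hsub

/-- Let `R` be a commutative ring.  If `R` has only finitely many minimal prime
ideals, then `R` has only finitely many idempotent elements. -/
theorem stmt8 (R : Type*) [CommRing R] (h : (minimalPrimes R).Finite) :
    {e : R | IsIdempotentElem e}.Finite :=
  Set.Finite.of_finite_image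
    (h.finite_subsets.subset (Set.image_subset_iff.mpr fun _ _ ↦ Set.sep_subset _ _))
    (IsIdempotentElem.injOn_minimalPrimes R)
end

section
/- Let R be a commutative ring with only finitely many idempotent elements, and let P be the set of primitive idempotents of R. Then P is finite, distinct elements e, e′ ∈ P satisfy e·e′ = 0, the sum of all elements of P equals 1, and the canonical ring homomorphism R → ∏_{e ∈ P} R/(1 − e) (given in each coordinate by the quotient map modulo the ideal generated by 1 − e) is bijective. -/
/-- The set of primitive idempotents of a commutative ring `R`: nonzero idempotents `e` such
that for every idempotent `e'` one has `e * e' = e` or `e * e' = 0`. -/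
def primitiveIdempotents (R : Type*) [CommRing R] : Set R :=
  {e | IsIdempotentElem e ∧ e ≠ 0 ∧
    ∀ e' : R, IsIdempotentElem e' → e * e' = e ∨ e * e' = 0}

theorem primitiveIdempotents.mul_eq_zero {R : Type*} [CommRing R] {e e' : R}
    (he : e ∈ primitiveIdempotents R) (he' : e' ∈ primitiveIdempotents R) (hne : e ≠ e') :
    e * e' = 0 := by
  rcases he.2.2 e' he'.1 with h₁ | h₁
  · rcases he'.2.2 e he.1 with h₂ | h₂
    · exact absurd (h₁.symm.trans ((mul_comm e e').trans h₂)) hne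
    · rwa [mul_comm]
  · exact h₁

/-- If a commutative ring has finitely many idempotents, every nonzero idempotent `f` lies above
a primitive one. -/
theorem exists_mem_primitiveIdempotents_mul_eq {R : Type*} [CommRing R]
    (h : {e : R | IsIdempotentElem e}.Finite) {f : R} (hf : IsIdempotentElem f) (hf₀ : f ≠ 0) :
    ∃ e ∈ primitiveIdempotents R, e * f = e := by
  -- Minimise the number of idempotents below `g`, among the nonzero idempotents `g` below `f`.
  let below (g : R) : Set R := {x | IsIdempotentElem x ∧ x * g = x}
  obtain ⟨e, ⟨he, he₀, hef⟩, hmin⟩ := Set.exists_min_image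
    {g : R | IsIdempotentElem g ∧ g ≠ 0 ∧ g * f = g} (fun g ↦ (below g).ncard)
    (h.subset fun _ hg ↦ hg.1) ⟨f, hf, hf₀, hf⟩
  refine ⟨e, ⟨he, he₀, fun e' he' ↦ ?_⟩, hef⟩
  by_contra! hne
  have hidem : IsIdempotentElem (e * e') := he.mul he'
  refine (hmin (e * e') ⟨hidem, hne.2, by rw [mul_right_comm, hef]⟩).not_gt ?_
  refine Set.ncard_lt_ncard ⟨fun x hx ↦ ⟨hx.1, ?_⟩, fun hsub ↦ hne.1 ?_⟩
    (h.subset fun _ hx ↦ hx.1)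
  · calc x * e = x * (e * e') * e := by rw [hx.2]
      _ = x * (e * e * e') := by ring
      _ = x := by rw [he.eq, hx.2]
  · have := (hsub ⟨he, he⟩).2
    rwa [← mul_assoc, he.eq] at this

theorem completeOrthogonalIdempotents_primitiveIdempotents {R : Type*} [CommRing R]
    (h : {e : R | IsIdempotentElem e}.Finite) [Fintype (primitiveIdempotents R)] :
    CompleteOrthogonalIdempotents (fun e : primitiveIdempotents R ↦ (e : R)) := by
  have ho : OrthogonalIdempotents (fun e : primitiveIdempotents R ↦ (e : R)) :=
    ⟨fun e ↦ e.2.1, fun e e' hne ↦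
      primitiveIdempotents.mul_eq_zero e.2 e'.2 (Subtype.coe_injective.ne hne)⟩
  refine ⟨ho, ?_⟩
  by_contra hne
  obtain ⟨e, he, hef⟩ := exists_mem_primitiveIdempotents_mul_eq h
    (ho.isIdempotentElem_sum (s := Finset.univ)).one_sub (sub_ne_zero.mpr (Ne.symm hne))
  rw [mul_sub, mul_one, ho.mul_sum_of_mem (i := ⟨e, he⟩) (Finset.mem_univ _), sub_self] at hef
  exact he.2.1 hef.symm

/-- Let `R` be a commutative ring with only finitely many idempotents and let
`P` be its set of primitive idempotents.  Then `P` is finite, distinct elements of `P` multiply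
to `0`, the elements of `P` sum to `1`, and the canonical ring homomorphism
`R → ∏_{e ∈ P} R ⧸ (1 - e)` is bijective. -/
theorem stmt9 (R : Type*) [CommRing R] (h : {e : R | IsIdempotentElem e}.Finite) :
    (primitiveIdempotents R).Finite ∧
      (∀ e ∈ primitiveIdempotents R, ∀ e' ∈ primitiveIdempotents R, e ≠ e' → e * e' = 0) ∧
      (∑ᶠ e ∈ primitiveIdempotents R, e) = 1 ∧
      Function.Bijective
        (Pi.ringHom fun e : primitiveIdempotents R =>
          Ideal.Quotient.mk (Ideal.span {1 - (e : R)})) := by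
  have hfin : (primitiveIdempotents R).Finite := h.subset fun _ he ↦ he.1
  have := hfin.fintype
  have hc := completeOrthogonalIdempotents_primitiveIdempotents h
  refine ⟨hfin, fun e he e' he' ↦ primitiveIdempotents.mul_eq_zero he he', ?_, hc.bijective_pi⟩
  rw [← finsum_set_coe_eq_finsum_mem, finsum_eq_sum_of_fintype, hc.complete]
end

section
/- Let k be a field of characteristic different from 2 and let L be a field extension of k of degree 2. Then there is exactly one pair (L₀, L₁) of k-submodules of L such that: L₀ ⊓ L₁ = 0 and L₀ + L₁ = L; 1 ∈ L₀; L₀·L₀ ⊆ L₀; L₀·L₁ ⊆ L₁; L₁·L₁ ⊆ L₀; and L₁ ≠ 0. (That is, L has exactly one non-trivial efficient ℤ/2ℤ-grading as a k-algebra.) -/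
/-- In a quadratic extension, `1` and any element outside the base field span. -/
theorem exists_algebraMap_add_smul_of_finrank_eq_two {k L : Type*} [Field k] [Field L]
    [Algebra k L] (hdim : Module.finrank k L = 2) {x : L} (hx : ∀ a : k, algebraMap k L a ≠ x)
    (z : L) : ∃ a b : k, z = algebraMap k L a + b • x := by
  have hli : LinearIndependent k ![(1 : L), x] := by
    rw [LinearIndependent.pair_iff' one_ne_zero]
    intro a
    rw [← Algebra.algebraMap_eq_smul_one]
    exact hx a
  have : FiniteDimensional k L := FiniteDimensional.of_finrank_eq_succ hdim
  have htop := hli.span_eq_top_of_card_eq_finrank' (by simp [hdim])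
  have hz : z ∈ Submodule.span k (Set.range ![(1 : L), x]) := htop ▸ Submodule.mem_top
  rw [Matrix.range_cons, Matrix.range_cons, Matrix.range_empty, Set.union_empty,
    Set.singleton_union, Submodule.mem_span_pair] at hz
  obtain ⟨a, b, h⟩ := hz
  exact ⟨a, b, by rw [← h, Algebra.algebraMap_eq_smul_one]⟩

/-- Away from characteristic two, a quadratic extension is generated by a square root. -/
theorem exists_sq_eq_algebraMap_of_finrank_eq_two {k L : Type*} [Field k] [Field L]
    [Algebra k L] (h2 : (2 : k) ≠ 0) (hdim : Module.finrank k L = 2) :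
    ∃ y : L, (∀ a : k, algebraMap k L a ≠ y) ∧ ∃ d : k, y * y = algebraMap k L d := by
  obtain ⟨x, hx⟩ : ∃ x : L, ∀ a : k, algebraMap k L a ≠ x := by
    by_contra! h
    have : Module.finrank k L ≤ 1 :=
      finrank_le_one (1 : L) fun w => (h w).imp fun a ha => by
        rw [← ha, Algebra.algebraMap_eq_smul_one]
    omega
  obtain ⟨a, b, hab⟩ := exists_algebraMap_add_smul_of_finrank_eq_two hdim hx (x * x)
  refine ⟨x - algebraMap k L (b / 2), fun c hc => hx (c + b / 2) ?_, a + b / 2 * (b / 2), ?_⟩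
  · rw [map_add, hc, sub_add_cancel]
  · have hb : algebraMap k L b = 2 * algebraMap k L (b / 2) := by
      rw [← map_ofNat (algebraMap k L) 2, ← map_mul, mul_div_cancel₀ b h2]
    rw [Algebra.smul_def, hb] at hab
    rw [map_add, map_mul]
    linear_combination hab

/-- Let `k` be a field of characteristic different from `2` and `L` a field
extension of `k` of degree `2`.  Then there is exactly one pair `(L₀, L₁)` of `k`-submodules of
`L` with `L₀ ⊓ L₁ = ⊥`, `L₀ ⊔ L₁ = ⊤`, `1 ∈ L₀`, `L₀·L₀ ⊆ L₀`, `L₀·L₁ ⊆ L₁`, `L₁·L₁ ⊆ L₀`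
and `L₁ ≠ ⊥`; i.e. `L` has exactly one non-trivial efficient `ℤ/2ℤ`-grading as a `k`-algebra. -/
theorem stmt11 (k L : Type*) [Field k] [Field L] [Algebra k L]
    (hchar : ringChar k ≠ 2) (hdim : Module.finrank k L = 2) :
    ∃! p : Submodule k L × Submodule k L,
      p.1 ⊓ p.2 = ⊥ ∧ p.1 ⊔ p.2 = ⊤ ∧ (1 : L) ∈ p.1 ∧
        p.1 * p.1 ≤ p.1 ∧ p.1 * p.2 ≤ p.2 ∧ p.2 * p.2 ≤ p.1 ∧ p.2 ≠ ⊥ := by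
  have h2 : (2 : k) ≠ 0 := Ring.two_ne_zero hchar
  have : FiniteDimensional k L := FiniteDimensional.of_finrank_eq_succ hdim
  obtain ⟨y, hy, d, hd⟩ := exists_sq_eq_algebraMap_of_finrank_eq_two h2 hdim
  have hy0 : y ≠ 0 := fun h => hy 0 (by rw [map_zero, h])
  refine ⟨(1, Submodule.span k {y}), ⟨?_, ?_, Submodule.one_le.1 le_rfl, ?_, ?_, ?_, ?_⟩, ?_⟩
  · rw [eq_bot_iff]
    rintro z ⟨hz1, hz2⟩
    obtain ⟨a, rfl⟩ := Submodule.mem_one.1 hz1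
    obtain ⟨b, hb⟩ := Submodule.mem_span_singleton.1 hz2
    by_cases hb0 : b = 0
    · simp [← hb, hb0]
    · refine absurd ?_ (hy (b⁻¹ * a))
      rw [map_mul, ← hb, ← Algebra.smul_def, smul_smul, inv_mul_cancel₀ hb0, one_smul]
  · rw [eq_top_iff]
    intro z _
    obtain ⟨a, b, rfl⟩ := exists_algebraMap_add_smul_of_finrank_eq_two hdim hy z
    exact Submodule.add_mem_sup (Submodule.mem_one.2 ⟨a, rfl⟩)
      (Submodule.smul_mem _ b (Submodule.mem_span_singleton_self y))
  · exact (mul_one _).le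
  · exact (one_mul _).le
  · rw [Submodule.span_mul_span, Set.singleton_mul_singleton, Submodule.span_singleton_le_iff_mem,
      hd]
    exact Submodule.mem_one.2 ⟨d, rfl⟩
  · simpa using hy0
  · rintro ⟨P, Q⟩ ⟨hinf, hsup, h1, -, -, hQQ, hQ⟩
    dsimp only at hinf hsup h1 hQQ hQ
    have hsum := Submodule.finrank_sup_add_finrank_inf_eq P Q
    rw [hinf, hsup, finrank_top, finrank_bot, hdim] at hsum
    have hQpos : 0 < Module.finrank k Q := Nat.pos_of_ne_zero (mt Submodule.finrank_eq_zero.1 hQ)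
    have hle : (1 : Submodule k L) ≤ P := Submodule.one_le.2 h1
    have hone : Module.finrank k (1 : Submodule k L) = 1 := by
      rw [Submodule.one_eq_span, finrank_span_singleton one_ne_zero]
    have hPpos := Submodule.finrank_mono hle
    have hP : 1 = P := Submodule.eq_of_le_of_finrank_le hle (by omega)
    subst hP
    have hQle : Q ≤ Submodule.span k {y} := by
      intro z hz
      obtain ⟨a, b, hab⟩ := exists_algebraMap_add_smul_of_finrank_eq_two hdim hy z
      obtain ⟨c, hc⟩ := Submodule.mem_one.1 (hQQ (Submodule.mul_mem_mul hz hz))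
      by_cases hb : b = 0
      · have hz1 : z ∈ (1 : Submodule k L) := Submodule.mem_one.2 ⟨a, by simp [hab, hb]⟩
        have hz0 : z ∈ (⊥ : Submodule k L) := hinf ▸ Submodule.mem_inf.2 ⟨hz1, hz⟩
        rw [(Submodule.mem_bot k).1 hz0]
        exact Submodule.zero_mem _
      · have ha : a = 0 := by
          by_contra ha
          have hne : 2 * a * b ≠ 0 := mul_ne_zero (mul_ne_zero h2 ha) hb
          refine hy ((2 * a * b)⁻¹ * (c - a * a - b * b * d)) ?_
          have hne' : algebraMap k L (2 * a * b) ≠ 0 := by simpa using hne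
          rw [map_mul, map_inv₀, inv_mul_eq_iff_eq_mul₀ hne']
          rw [hab, Algebra.smul_def] at hc
          simp only [map_sub, map_mul, map_ofNat]
          linear_combination hc + algebraMap k L b * algebraMap k L b * hd
        rw [hab, ha, map_zero, zero_add]
        exact Submodule.smul_mem _ b (Submodule.mem_span_singleton_self y)
    rw [Submodule.eq_of_le_of_finrank_le hQle (by rw [finrank_span_singleton hy0]; omega)]
end

section
/- Let E be a commutative reduced ℚ-algebra that is finite-dimensional over ℚ, let n ≥ 1 be an integer, let K be the n-th cyclotomic field over ℚ, and let E′ = E ⊗_ℚ K. Then for all x, y ∈ E: ∑_{σ : E′ →+* ℂ} σ(x ⊗ 1)·conj(σ(y ⊗ 1)) = φ(n) · ∑_{σ : E →+* ℂ} σ(x)·conj(σ(y)), where both sums range over all ring homomorphisms into ℂ (these are finite sets) and φ is Euler's totient function. -/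
open scoped TensorProduct

/-- Ring homomorphisms from a tensor product of `ℚ`-algebras into a `ℚ`-algebra are pairs of ring
homomorphisms from the two factors. -/
noncomputable def ringHomTensorProductEquiv (A B C : Type*) [CommRing A] [CommRing B] [CommRing C]
    [Algebra ℚ A] [Algebra ℚ B] [Algebra ℚ C] :
    (A ⊗[ℚ] B →+* C) ≃ (A →+* C) × (B →+* C) where
  toFun σ := (σ.comp Algebra.TensorProduct.includeLeftRingHom,
    σ.comp (Algebra.TensorProduct.includeRight : B →ₐ[ℚ] A ⊗[ℚ] B).toRingHom)
  invFun p := (Algebra.TensorProduct.productMap p.1.toRatAlgHom p.2.toRatAlgHom).toRingHom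
  left_inv σ := by
    apply (RingHom.equivRatAlgHom _ _).injective
    ext <;> simp [← map_mul]
  right_inv p := by ext <;> simp

/-- A finite-dimensional commutative `ℚ`-algebra has finitely many ring homomorphisms into `ℂ`. -/
theorem finite_ringHom_complex (A : Type*) [CommRing A] [Algebra ℚ A] [FiniteDimensional ℚ A] :
    Finite (A →+* ℂ) :=
  Finite.of_equiv (A →ₐ[ℚ] ℂ) (RingHom.equivRatAlgHom A ℂ).symm

/-- Let `E` be a commutative reduced `ℚ`-algebra, finite-dimensional over `ℚ`,
let `n ≥ 1`, `K` the `n`-th cyclotomic field over `ℚ` and `E' = E ⊗[ℚ] K`.  Then for `x y ∈ E`,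
`∑_{σ : E' →+* ℂ} σ(x ⊗ 1) * conj (σ (y ⊗ 1)) = φ(n) * ∑_{σ : E →+* ℂ} σ x * conj (σ y)`
(the sums, over the finitely many ring homomorphisms into `ℂ`, are taken as `finsum`s). -/
theorem stmt12 (E : Type*) [CommRing E] [IsReduced E] [Algebra ℚ E]
    [FiniteDimensional ℚ E] (n : ℕ+) (x y : E) :
    ∑ᶠ σ : (E ⊗[ℚ] CyclotomicField n ℚ) →+* ℂ,
        σ (x ⊗ₜ[ℚ] (1 : CyclotomicField n ℚ)) *
          (starRingEnd ℂ) (σ (y ⊗ₜ[ℚ] (1 : CyclotomicField n ℚ))) =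
      (Nat.totient n : ℂ) * ∑ᶠ σ : E →+* ℂ, σ x * (starRingEnd ℂ) (σ y) := by
  have := finite_ringHom_complex E
  have := Fintype.ofFinite (E →+* ℂ)
  have hcard : Fintype.card (CyclotomicField n ℚ →+* ℂ) = Nat.totient n := by
    have : IsCyclotomicExtension {(n : ℕ)} ℚ (CyclotomicField n ℚ) := by
      convert CyclotomicField.isCyclotomicExtension (n : ℕ) ℚ
      · rfl
      · exact Subsingleton.elim (α := Algebra ℚ (CyclotomicField n ℚ)) _ _
    rw [NumberField.Embeddings.card]
    exact IsCyclotomicExtension.Rat.finrank n (CyclotomicField n ℚ)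
  calc
    _ = ∑ᶠ p : (E →+* ℂ) × (CyclotomicField n ℚ →+* ℂ), p.1 x * (starRingEnd ℂ) (p.1 y) :=
      finsum_eq_of_bijective _ (ringHomTensorProductEquiv E (CyclotomicField n ℚ) ℂ).bijective
        fun _ => rfl
    _ = _ := by
      rw [finsum_eq_sum_of_fintype, finsum_eq_sum_of_fintype, Fintype.sum_prod_type]
      simp [hcard, Finset.mul_sum]
end

section
/- Let R be a reduced order, let Γ be a group, and let (R_γ)_{γ ∈ Γ} be a Γ-grading of R as a ℤ-algebra. Then for all γ, δ ∈ Γ with γ ≠ δ and all x ∈ R_γ, y ∈ R_δ one has ∑_{σ : R →+* ℂ} σ(x)·conj(σ(y)) = 0, where the sum ranges over all ring homomorphisms R →+* ℂ (a finite set) and conj denotes complex conjugation. -/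
open scoped TensorProduct in
/-- After base change to `ℂ`, a reduced order becomes a finite power of `ℂ`. -/
theorem isFiniteSplit_complex_of_isReduced (R : Type*) [CommRing R] [IsReduced R]
    [Module.Free ℤ R] [Module.Finite ℤ R] : Algebra.IsFiniteSplit ℂ (ℂ ⊗[ℤ] R) := by
  have hred : IsReduced (ℚ ⊗[ℤ] R) := by
    have : IsReduced (R ⊗[ℤ] ℚ) :=
      isReduced_localizationPreserves
        (Algebra.algebraMapSubmonoid R (nonZeroDivisors ℤ)) (R ⊗[ℤ] ℚ) inferInstance
    exact isReduced_of_injective (Algebra.TensorProduct.comm ℤ ℚ R)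
      (Algebra.TensorProduct.comm ℤ ℚ R).injective
  have : IsArtinianRing (ℚ ⊗[ℤ] R) := .of_finite ℚ _
  let (m : MaximalSpectrum (ℚ ⊗[ℤ] R)) : Field ((ℚ ⊗[ℤ] R) ⧸ m.asIdeal) :=
    Ideal.Quotient.field m.asIdeal
  have hpi : Algebra.FormallyEtale ℚ
      (∀ m : MaximalSpectrum (ℚ ⊗[ℤ] R), (ℚ ⊗[ℤ] R) ⧸ m.asIdeal) := by
    rw [Algebra.FormallyEtale.pi_iff]
    exact fun m ↦ Algebra.FormallyEtale.of_isSeparable ℚ _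
  have hQ : Algebra.FormallyEtale ℚ (ℚ ⊗[ℤ] R) :=
    .of_equiv ((IsArtinianRing.equivPi (ℚ ⊗[ℤ] R)).restrictScalars ℚ).symm
  have hC : Algebra.FormallyEtale ℂ (ℂ ⊗[ℤ] R) :=
    .of_equiv (Algebra.TensorProduct.cancelBaseChange ℤ ℚ ℂ ℂ R)
  infer_instance

/-- The trace of an element of a finite power of a commutative ring is the sum of its entries. -/
theorem Algebra.trace_pi_self_apply (K ι : Type*) [CommRing K] [Fintype ι] (f : ι → K) :
    Algebra.trace K (ι → K) f = ∑ i, f i := by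
  classical
  rw [Algebra.trace_eq_matrix_trace (Pi.basisFun K ι), Matrix.trace]
  simp [Algebra.leftMulMatrix_eq_repr_mul]

/-- Algebra homomorphisms from a finite power of a field to the field are evaluations. -/
theorem AlgHom.exists_eq_evalAlgHom {K ι : Type*} [Field K] [_root_.Finite ι]
    (φ : (ι → K) →ₐ[K] K) : ∃ i, φ = Pi.evalAlgHom K (fun _ ↦ K) i := by
  classical
  cases nonempty_fintype ι
  obtain ⟨i, hi⟩ : ∃ i, φ (Pi.single i 1) ≠ 0 := by
    by_contra! h
    have h1 : φ (∑ i, Pi.single i 1) = 1 := by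
      rw [show ∑ i, Pi.single i (1 : K) = (1 : ι → K) from Finset.univ_sum_single 1, map_one]
    simp [map_sum, h] at h1
  refine ⟨i, AlgHom.ext fun f ↦ mul_right_cancel₀ hi ?_⟩
  have : f * Pi.single i 1 = f i • Pi.single i (1 : K) := by
    ext j
    rcases eq_or_ne j i with rfl | h <;> simp [*]
  rw [← map_mul, this, map_smul, smul_eq_mul, Pi.evalAlgHom_apply]

open scoped TensorProduct in
/-- A reduced order has finitely many complex embeddings, and its trace is the sum over them. -/
theorem finite_ringHom_and_trace_eq_sum (R : Type*) [CommRing R] [IsReduced R]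
    [Module.Free ℤ R] [Module.Finite ℤ R] :
    Finite (R →+* ℂ) ∧
      ∀ z : R, ∑ᶠ σ : R →+* ℂ, σ z = ((Algebra.trace ℤ R z : ℤ) : ℂ) := by
  obtain ⟨n, ⟨e⟩⟩ :=
    (isFiniteSplit_complex_of_isReduced R).nonempty_algEquiv_fun
  let s (i : Fin n) : R →+* ℂ :=
    ((Pi.evalRingHom (fun _ : Fin n ↦ ℂ) i).comp (e : ℂ ⊗[ℤ] R →+* (Fin n → ℂ))).comp
      (Algebra.TensorProduct.includeRight : R →ₐ[ℤ] ℂ ⊗[ℤ] R).toRingHom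
  have hs (i : Fin n) (z : R) : s i z = e (1 ⊗ₜ z) i := rfl
  have hinj : Function.Injective s := by
    intro i j hij
    have key (w : ℂ ⊗[ℤ] R) : e w i = e w j := by
      induction w with
      | zero => simp
      | add a b ha hb => simp [ha, hb]
      | tmul c z =>
        have h : c ⊗ₜ[ℤ] z = c • (1 ⊗ₜ[ℤ] z) := by simp [TensorProduct.smul_tmul']
        rw [h, map_smul, Pi.smul_apply, Pi.smul_apply, ← hs, ← hs, hij]
    by_contra hne
    have := key (e.symm (Pi.single i 1))
    simp [Ne.symm hne] at this
  have hsurj : Function.Surjective s := by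
    intro σ
    let φ : ℂ ⊗[ℤ] R →ₐ[ℂ] ℂ :=
      Algebra.TensorProduct.lift (Algebra.ofId ℂ ℂ) σ.toIntAlgHom fun _ _ ↦ Commute.all _ _
    obtain ⟨i, hi⟩ := AlgHom.exists_eq_evalAlgHom (φ.comp e.symm.toAlgHom)
    refine ⟨i, RingHom.ext fun z ↦ ?_⟩
    have := DFunLike.congr_fun hi (e (1 ⊗ₜ z))
    simpa [φ, hs] using this.symm
  refine ⟨Finite.of_surjective s hsurj, fun z ↦ ?_⟩
  have hsum : ∑ᶠ σ : R →+* ℂ, σ z = ∑ i, e (1 ⊗ₜ z) i := by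
    rw [← finsum_eq_sum_of_fintype]
    exact (finsum_eq_of_bijective s ⟨hinj, hsurj⟩ fun i ↦ (hs i z).symm).symm
  have hmul : Algebra.lmul ℂ (ℂ ⊗[ℤ] R) (1 ⊗ₜ z) = (Algebra.lmul ℤ R z).baseChange ℂ := by
    ext w
    simp
  rw [hsum, ← Algebra.trace_pi_self_apply, Algebra.trace_eq_of_algEquiv e, Algebra.trace_apply, hmul,
    LinearMap.trace_baseChange]
  rfl

/-- In a graded order, homogeneous elements of nontrivial degree have trace zero. -/
theorem trace_eq_zero_of_mem_of_ne_one {R Γ : Type*} [CommRing R]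
    [Module.Free ℤ R] [Module.Finite ℤ R] [Group Γ] {Rg : Γ → Submodule ℤ R}
    (hind : iSupIndep Rg) (hsup : (⨆ γ, Rg γ) = ⊤)
    (hmul : ∀ γ δ : Γ, ∀ x ∈ Rg γ, ∀ y ∈ Rg δ, x * y ∈ Rg (γ * δ))
    {ε : Γ} (hε : ε ≠ 1) {z : R} (hz : z ∈ Rg ε) : Algebra.trace ℤ R z = 0 := by
  classical
  exact LinearMap.trace_eq_zero_of_mapsTo_ne
    (DirectSum.isInternal_submodule_of_iSupIndep_of_iSup_eq_top hind hsup)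
    (ε * ·) (fun i ↦ by simpa using hε) fun i w hw ↦ hmul ε i z hz w hw

/-- On a finite set of complex numbers, conjugation agrees with `w ↦ w ^ m * p (w ^ (m + 1))`
for some polynomial `p`. -/
theorem exists_polynomial_conj_eq (S : Finset ℂ) (m : ℕ) :
    ∃ p : Polynomial ℂ, ∀ w ∈ S, (starRingEnd ℂ) w = w ^ m * p.eval (w ^ (m + 1)) := by
  classical
  let g (t : ℂ) : ℂ := (((‖t‖ ^ (((m + 1 : ℕ) : ℝ)⁻¹)) ^ 2 : ℝ) : ℂ) / t
  refine ⟨Lagrange.interpolate (S.image (· ^ (m + 1))) id g, fun w hw ↦ ?_⟩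
  have hev : (Lagrange.interpolate (S.image (· ^ (m + 1))) id g).eval (w ^ (m + 1)) =
      g (w ^ (m + 1)) :=
    Lagrange.eval_interpolate_at_node (v := id) g Function.injective_id.injOn
      (Finset.mem_image_of_mem _ hw)
  rw [hev]
  simp only [g]
  rw [norm_pow, Real.pow_rpow_inv_natCast (norm_nonneg w) m.succ_ne_zero]
  rcases eq_or_ne w 0 with rfl | h0
  · simp
  · rw [Complex.ofReal_pow, ← Complex.mul_conj']
    field_simp
    ring

/-- Powers of homogeneous elements of a graded ring are homogeneous. -/
theorem pow_mem_graded_pow {R Γ : Type*} [CommRing R] [Group Γ] {Rg : Γ → Submodule ℤ R}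
    (hone : (1 : R) ∈ Rg 1)
    (hmul : ∀ γ δ : Γ, ∀ x ∈ Rg γ, ∀ y ∈ Rg δ, x * y ∈ Rg (γ * δ))
    {δ : Γ} {y : R} (hy : y ∈ Rg δ) (k : ℕ) : y ^ k ∈ Rg (δ ^ k) := by
  induction k with
  | zero => simpa using hone
  | succ k ih => simpa only [pow_succ] using hmul _ _ _ ih _ hy

/-- In a reduced graded order, homogeneous elements of infinite-order degree vanish. -/
theorem eq_zero_of_mem_of_not_isOfFinOrder {R Γ : Type*} [CommRing R] [IsReduced R]
    [Module.Finite ℤ R] [Group Γ] {Rg : Γ → Submodule ℤ R}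
    (hind : iSupIndep Rg) (hone : (1 : R) ∈ Rg 1)
    (hmul : ∀ γ δ : Γ, ∀ x ∈ Rg γ, ∀ y ∈ Rg δ, x * y ∈ Rg (γ * δ))
    {δ : Γ} (hδ : ¬ IsOfFinOrder δ) {y : R} (hy : y ∈ Rg δ) : y = 0 := by
  by_contra hy0
  have hfin : {γ | Rg γ ≠ ⊥}.Finite := WellFoundedGT.finite_ne_bot_of_iSupIndep hind
  refine Set.infinite_of_injective_forall_mem (injective_pow_iff_not_isOfFinOrder.mpr hδ)
    (fun k ↦ show Rg (δ ^ k) ≠ ⊥ from fun hk ↦ pow_ne_zero k hy0 ?_) hfin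
  simpa [hk] using pow_mem_graded_pow hone hmul hy k

/-- Let `R` be a reduced order (a commutative reduced ring whose additive
group is a free `ℤ`-module of finite rank), `Γ` a group and `(R_γ)_{γ ∈ Γ}` a `Γ`-grading of
`R` as a `ℤ`-algebra.  Then for `γ ≠ δ` and `x ∈ R_γ`, `y ∈ R_δ` one has
`∑_{σ : R →+* ℂ} σ x * conj (σ y) = 0` (a `finsum` over the finitely many ring homomorphisms
`R →+* ℂ`). -/
theorem stmt13 (R : Type*) [CommRing R] [IsReduced R]
    [Module.Free ℤ R] [Module.Finite ℤ R]
    (Γ : Type*) [Group Γ] (Rg : Γ → Submodule ℤ R)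
    (hind : iSupIndep Rg) (hsup : (⨆ γ, Rg γ) = ⊤)
    (hone : (1 : R) ∈ Rg 1)
    (hmul : ∀ γ δ : Γ, ∀ x ∈ Rg γ, ∀ y ∈ Rg δ, x * y ∈ Rg (γ * δ)) :
    ∀ γ δ : Γ, γ ≠ δ → ∀ x ∈ Rg γ, ∀ y ∈ Rg δ,
      ∑ᶠ σ : R →+* ℂ, σ x * (starRingEnd ℂ) (σ y) = 0 := by
  intro γ δ hγδ x hx y hy
  obtain ⟨hfin, htrace⟩ := finite_ringHom_and_trace_eq_sum R
  cases nonempty_fintype (R →+* ℂ)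
  by_cases hδ : IsOfFinOrder δ
  · obtain ⟨m, hm⟩ : ∃ m, orderOf δ = m + 1 := Nat.exists_eq_succ_of_ne_zero hδ.orderOf_pos.ne'
    have hpow : δ ^ (m + 1) = 1 := hm ▸ pow_orderOf_eq_one δ
    obtain ⟨p, hp⟩ := exists_polynomial_conj_eq (Finset.univ.image fun σ : R →+* ℂ ↦ σ y) m
    have hzero (k : ℕ) : ∑ σ : R →+* ℂ, σ (x * y ^ (m + (m + 1) * k)) = 0 := by
      rw [← finsum_eq_sum_of_fintype, htrace, Int.cast_eq_zero]
      refine trace_eq_zero_of_mem_of_ne_one hind hsup hmul (fun h ↦ hγδ ?_)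
        (hmul _ _ _ hx _ (pow_mem_graded_pow hone hmul hy _))
      rw [pow_add, pow_mul, hpow, one_pow, mul_one] at h
      rw [← mul_right_cancel_iff (a := δ ^ m), h, ← pow_succ', hpow]
    rw [finsum_eq_sum_of_fintype]
    calc ∑ σ : R →+* ℂ, σ x * (starRingEnd ℂ) (σ y)
        = ∑ σ : R →+* ℂ, ∑ k ∈ Finset.range (p.natDegree + 1),
            p.coeff k * σ (x * y ^ (m + (m + 1) * k)) := by
          refine Finset.sum_congr rfl fun σ _ ↦ ?_
          rw [hp _ (Finset.mem_image_of_mem _ (Finset.mem_univ σ)),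
            Polynomial.eval_eq_sum_range, Finset.mul_sum, Finset.mul_sum]
          refine Finset.sum_congr rfl fun k _ ↦ ?_
          rw [map_mul, map_pow, pow_add _ m (_ * k), pow_mul]
          ring
      _ = 0 := by
          rw [Finset.sum_comm]
          simp only [← Finset.mul_sum, hzero, mul_zero, Finset.sum_const_zero]
  · simp [eq_zero_of_mem_of_not_isOfFinOrder hind hone hmul hδ hy]
end

section
/- Let k be a commutative Noetherian ring and let R be a commutative reduced k-algebra that is finitely generated as a k-module. Then the group of k-algebra automorphisms of R is finite. -/
/-- A finite algebra has only finitely many algebra homomorphisms to a given domain: each generator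
has to go to a root of a monic polynomial that it satisfies. -/
theorem finite_algHom_of_moduleFinite_of_isDomain (k R D : Type*) [CommRing k] [CommRing R]
    [CommRing D] [IsDomain D] [Algebra k R] [Algebra k D] [Module.Finite k R] :
    Finite (R →ₐ[k] D) := by
  obtain ⟨s, hs⟩ := Algebra.FiniteType.out (R := k) (A := R)
  have hint (x : R) : IsIntegral k x := Algebra.IsIntegral.isIntegral x
  have hroot (f : R →ₐ[k] D) (x : R) : f x ∈ (minpoly k x).rootSet D := by
    rw [Polynomial.mem_rootSet']
    refine ⟨((minpoly.monic (hint x)).map _).ne_zero, ?_⟩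
    rw [Polynomial.aeval_algHom_apply, minpoly.aeval, map_zero]
  refine Finite.of_injective
    (fun f (x : s) ↦ (⟨f x, hroot f x⟩ : (minpoly k (x : R)).rootSet D)) fun f g h ↦ ?_
  refine AlgHom.ext_of_adjoin_eq_top hs fun x hx ↦ ?_
  exact congrArg Subtype.val (congrFun h ⟨x, hx⟩)

/-- Let `k` be a commutative Noetherian ring and `R` a commutative reduced
`k`-algebra that is finitely generated as a `k`-module.  Then the group of `k`-algebra
automorphisms of `R` is finite. -/
theorem stmt14 (k : Type*) [CommRing k] [IsNoetherianRing k]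
    (R : Type*) [CommRing R] [IsReduced R] [Algebra k R] [Module.Finite k R] :
    Finite (R ≃ₐ[k] R) := by
  have : IsNoetherianRing R := IsNoetherianRing.of_finite k R
  have : Finite (minimalPrimes R) := (minimalPrimes.finite_of_isNoetherianRing R).to_subtype
  have (p : minimalPrimes R) : Finite (R →ₐ[k] R ⧸ p.1) :=
    have : p.1.IsPrime := Ideal.IsMinimalPrime.isPrime p.2
    finite_algHom_of_moduleFinite_of_isDomain k R (R ⧸ p.1)
  refine Finite.of_injective
    (fun (e : R ≃ₐ[k] R) (p : minimalPrimes R) ↦ (Ideal.Quotient.mkₐ k p.1).comp e.toAlgHom)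
    fun e f h ↦ AlgEquiv.ext fun x ↦ ?_
  rw [← sub_eq_zero, ← Ideal.mem_bot, ← Ideal.zero_eq_bot, ← nilradical_eq_zero R, nilradical,
    ← Ideal.sInf_minimalPrimes, Submodule.mem_sInf]
  intro p hp
  exact Ideal.Quotient.eq.mp (DFunLike.congr_fun (congrFun h ⟨p, hp⟩) x)
end

section
/- Let k be a commutative Noetherian ring and let M be a finitely generated k-module. Then there exists a natural number c such that for every index type ι and every family (M_i)_{i ∈ ι} of k-submodules of M for which M is the internal direct sum of the M_i, the set {i ∈ ι | M_i ≠ 0} is finite and has at most c elements. -/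
universe u

open Module Submodule

/-- Elements with annihilator exactly `p`, taken from the members of an independent family of
submodules, are linearly independent over `k ⧸ p`. -/
theorem iSupIndep.linearIndependent_torsionBySet {k M ι : Type*} [CommRing k] [AddCommGroup M]
    [Module k M] {N : ι → Submodule k M} (hN : iSupIndep N) (p : Ideal k)
    (x : ι → torsionBySet k M p) (hxN : ∀ i, (x i : M) ∈ N i)
    (hx : ∀ i (a : k), a • (x i : M) = 0 → a ∈ p) :
    LinearIndependent (k ⧸ p) x := by
  rw [linearIndependent_iff']
  intro s g hg i hi
  choose a ha using fun j => Ideal.Quotient.mk_surjective (I := p) (g j)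
  have hsum : ∑ j ∈ s, a j • (x j : M) = 0 := by
    simpa [← ha] using congrArg Subtype.val hg
  rw [← ha i, Ideal.Quotient.eq_zero_iff_mem]
  exact hx i _ ((iSupIndep_iff_finsetSum_eq_zero_imp_eq_zero N).1 hN s _
    (fun j _ => (N j).smul_mem _ (hxN j)) hsum i hi)

/-- The members of an independent family having `p` as an associated prime number at most the
rank over `k ⧸ p` of the `p`-torsion of `M`. -/
theorem iSupIndep.card_le_finrank_torsionBySet {k M ι : Type*} [CommRing k] [IsNoetherianRing k]
    [AddCommGroup M] [Module k M] [Module.Finite k M] [Fintype ι] {N : ι → Submodule k M}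
    (hN : iSupIndep N) (p : Ideal k) (hp : ∀ i, IsAssociatedPrime p (N i)) :
    Fintype.card ι ≤ finrank (k ⧸ p) (torsionBySet k M p) := by
  cases isEmpty_or_nonempty ι
  · simp
  have : p.IsPrime := (hp (Classical.arbitrary ι)).isPrime
  choose y hy using fun i => (isAssociatedPrime_iff.1 (hp i)).2
  have hmem : ∀ i (a : k), a ∈ p ↔ a • (y i : M) = 0 := fun i a => by
    rw [hy i, mem_colon_singleton, mem_bot, ← Submodule.coe_smul, Submodule.coe_eq_zero]
  have : Module.Finite (k ⧸ p) (torsionBySet k M p) := .of_restrictScalars_finite k _ _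
  exact (hN.linearIndependent_torsionBySet p
    (fun i => ⟨y i, (mem_torsionBySet_iff _ _).2 fun a => (hmem i a).1 a.2⟩)
    (fun i => (y i).2) fun i a => (hmem i a).2).fintype_card_le_finrank

/-- Let `k` be a commutative Noetherian ring and `M` a finitely generated
`k`-module.  Then there is `c : ℕ` such that for every family `(M_i)_{i ∈ ι}` of submodules of
`M` of which `M` is the internal direct sum, the set of indices `i` with `M_i ≠ ⊥` is finite of
cardinality at most `c`. -/
theorem stmt15 (k : Type*) [CommRing k] [IsNoetherianRing k]
    (M : Type*) [AddCommGroup M] [Module k M] [Module.Finite k M] :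
    ∃ c : ℕ, ∀ (ι : Type u) (Mi : ι → Submodule k M),
      iSupIndep Mi → (⨆ i, Mi i) = ⊤ →
      {i : ι | Mi i ≠ ⊥}.Finite ∧ {i : ι | Mi i ≠ ⊥}.ncard ≤ c := by
  classical
  have hfin := associatedPrimes.finite k M
  refine ⟨∑ p ∈ hfin.toFinset, finrank (k ⧸ p) (torsionBySet k M p), fun ι N hN _ => ?_⟩
  have hS : {i : ι | N i ≠ ⊥}.Finite := WellFoundedGT.finite_ne_bot_of_iSupIndep hN
  refine ⟨hS, ?_⟩
  have hex : ∀ i, ∃ p : Ideal k, N i ≠ ⊥ → IsAssociatedPrime p (N i) := fun i => by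
    by_cases h : N i = ⊥
    · exact ⟨⊥, fun h' => absurd h h'⟩
    · have := nontrivial_iff_ne_bot.2 h
      exact (associatedPrimes.nonempty k (N i)).imp fun _ hp _ => hp
  choose f hf using hex
  rw [Set.ncard_eq_toFinset_card _ hS, Finset.card_eq_sum_card_fiberwise (f := f)
    (t := hfin.toFinset)]
  · refine Finset.sum_le_sum fun p _ => ?_
    rw [← Fintype.card_coe]
    refine (hN.comp Subtype.val_injective).card_le_finrank_torsionBySet p ?_
    rintro ⟨i, hi⟩
    rw [Finset.mem_filter, hS.mem_toFinset] at hi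
    exact hi.2 ▸ hf i hi.1
  · intro i hi
    rw [Finset.mem_coe, hS.mem_toFinset] at hi
    rw [Finset.mem_coe, hfin.mem_toFinset]
    exact (hf i hi).map_of_injective (N i).subtype (N i).injective_subtype
end

section
/- Let e ≥ 1 be an integer and let R be a commutative reduced ring on which multiplication by e is injective. Then R ⊗_ℤ ℤ[ζ_e] is reduced, where ℤ[ζ_e] is the e-th cyclotomic ring over ℤ (the subring of the e-th cyclotomic field generated over ℤ by a primitive e-th root of unity). -/
open scoped TensorProduct

set_option synthInstance.maxHeartbeats 1000000
set_option maxHeartbeats 2000000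

open Polynomial in
/-- Over a reduced ring on which `e` is a nonzerodivisor, a monic divisor of `X ^ e - 1` generates
a radical ideal: this may be tested modulo every prime ideal not containing `e`, where
`X ^ e - 1` is separable over the fraction field of the quotient. -/
theorem Polynomial.Monic.isRadical_of_dvd_X_pow_sub_one {R : Type*} [CommRing R] [IsReduced R]
    {e : ℕ} (he : Function.Injective fun r : R => (e : R) * r) {P : R[X]} (hP : P.Monic)
    (hdvd : P ∣ X ^ e - 1) : IsRadical P := by
  intro n g hg
  rw [← modByMonic_eq_zero_iff_dvd hP]
  ext i
  apply he
  simp only [coeff_zero, mul_zero]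
  suffices h : (e : R) * (g %ₘ P).coeff i ∈ nilradical R from (mem_nilradical.1 h).eq_zero
  rw [nilradical_eq_sInf, Submodule.mem_sInf]
  intro p (hp : Ideal.IsPrime p)
  by_cases hep : (e : R) ∈ p
  · exact Ideal.mul_mem_right _ p hep
  refine Ideal.mul_mem_left p _ ?_
  let f : R →+* FractionRing (R ⧸ p) := (algebraMap (R ⧸ p) _).comp (Ideal.Quotient.mk p)
  have hf (r : R) (hr : f r = 0) : r ∈ p := by
    rw [← Ideal.Quotient.eq_zero_iff_mem]
    exact IsFractionRing.injective (R ⧸ p) (FractionRing (R ⧸ p)) (by simpa [f] using hr)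
  have hsep : (X ^ e - 1 : (FractionRing (R ⧸ p))[X]).Separable :=
    X_pow_sub_one_separable_iff.2 fun h => hep (hf _ (by rwa [map_natCast]))
  have hPdvd : P.map f ∣ X ^ e - 1 := by simpa using Polynomial.map_dvd f hdvd
  have hgdvd : P.map f ∣ g.map f :=
    (hsep.of_dvd hPdvd).squarefree.isRadical n _ (by simpa using Polynomial.map_dvd f hg)
  apply hf
  rw [← coeff_map, map_modByMonic f hP, (modByMonic_eq_zero_iff_dvd (hP.map f)).2 hgdvd,
    coeff_zero]

theorem AdjoinRoot.isReduced_of_isRadical {R : Type*} [CommRing R] {P : Polynomial R}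
    (hP : IsRadical P) : IsReduced (AdjoinRoot P) := by
  refine ⟨fun x ⟨n, hn⟩ => ?_⟩
  obtain ⟨g, rfl⟩ := AdjoinRoot.mk_surjective x
  rw [← map_pow, AdjoinRoot.mk_eq_zero] at hn
  exact AdjoinRoot.mk_eq_zero.2 (hP n g hn)

/-- Let `e ≥ 1` and let `R` be a commutative reduced ring on which
multiplication by `e` is injective.  Then `R ⊗[ℤ] ℤ[ζ_e]` is reduced, where
`ℤ[ζ_e] = Algebra.adjoin ℤ {ζ}` for a primitive `e`-th root of unity `ζ` in the `e`-th
cyclotomic field. -/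
theorem stmt16 (e : ℕ+) (ζ : CyclotomicField e ℚ) (hζ : IsPrimitiveRoot ζ (e : ℕ))
    (R : Type*) [CommRing R] [IsReduced R]
    (hR : Function.Injective fun r : R => (e : ℕ) * r) :
    IsReduced (R ⊗[ℤ] (Algebra.adjoin ℤ ({ζ} : Set (CyclotomicField e ℚ)))) := by
  have hint : IsIntegral ℤ ζ := hζ.isIntegral e.pos
  let φ := Algebra.TensorProduct.rid ℤ ℤ R
  have : IsReduced (R ⊗[ℤ] ℤ) := isReduced_of_injective φ φ.injective
  have hinj : Function.Injective fun r : R ⊗[ℤ] ℤ => ((e : ℕ) : R ⊗[ℤ] ℤ) * r := fun a b hab =>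
    φ.injective (hR (by simpa using congrArg φ hab))
  let ι : ℤ →+* R ⊗[ℤ] ℤ :=
    (Algebra.TensorProduct.includeRight : ℤ →ₐ[ℤ] R ⊗[ℤ] ℤ).toRingHom
  have hdvd : minpoly ℤ ζ ∣ Polynomial.X ^ (e : ℕ) - 1 :=
    minpoly.isIntegrallyClosed_dvd hint (by simp [hζ.pow_eq_one])
  have hrad : IsRadical ((minpoly ℤ ζ).map ι) :=
    ((minpoly.monic hint).map ι).isRadical_of_dvd_X_pow_sub_one hinj
      (by simpa using Polynomial.map_dvd ι hdvd)
  have := AdjoinRoot.isReduced_of_isRadical hrad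
  let ψ := (Algebra.TensorProduct.congr (AlgEquiv.refl : R ≃ₐ[ℤ] R)
    (minpoly.equivAdjoin hint).symm).toRingEquiv.trans
      (AdjoinRoot.tensorAlgEquiv (R := ℤ) (T := R) (minpoly ℤ ζ) _ rfl).toRingEquiv
  exact isReduced_of_injective ψ ψ.injective
end

section
/- Let k be a ring, A a k-module, B a submodule of A, and let (A_i)_{i ∈ I} be a family of submodules of A indexed by a finite type I such that A is the internal direct sum of the A_i. Then there exist a type U and a surjective map u : I → U such that: (i) the pushforward decomposition restricts to B, i.e. B is the supremum over j ∈ U of the submodules (⨆_{i ∈ u⁻¹(j)} A_i) ⊓ B and this family of intersections is independent; and (ii) for every type J and every map f : I → J such that B = ⨆_{j ∈ J} ((⨆_{i ∈ f⁻¹(j)} A_i) ⊓ B), there exists a map g : U → J with f = g ∘ u. -/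
universe u v

section Projections

variable {k A I : Type*} [Ring k] [AddCommGroup A] [Module k A]

/-- The coordinate projections of an internal direct sum over a finite type. -/
theorem exists_projections_of_iSupIndep [Fintype I] (Ai : I → Submodule k A)
    (hind : iSupIndep Ai) (hsup : (⨆ i, Ai i) = ⊤) :
    ∃ P : I → A →ₗ[k] A, (∀ i x, P i x ∈ Ai i) ∧
      (∀ i j, i ≠ j → ∀ x ∈ Ai j, P i x = 0) ∧ ∀ x, ∑ i, P i x = x := by
  classical
  have hint := DirectSum.isInternal_submodule_of_iSupIndep_of_iSup_eq_top hind hsup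
  let := hint.chooseDecomposition
  refine ⟨fun i => (Ai i).subtype ∘ₗ DirectSum.component k I (fun i => Ai i) i ∘ₗ
    (DirectSum.decomposeLinearEquiv Ai).toLinearMap, fun i x => ?_,
    fun i j hij x hx => ?_, fun x => ?_⟩
  · exact Submodule.coe_mem _
  · exact DirectSum.decompose_of_mem_ne Ai hx hij.symm
  · refine Eq.trans (Finset.sum_subset (Finset.subset_univ _) fun i _ hi => ?_).symm
      (DirectSum.sum_support_decompose Ai x)
    have h : DirectSum.decompose Ai x i = 0 := DFinsupp.notMem_support_iff.mp hi
    exact congrArg Subtype.val h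

/-- The submodule `B` is stable under the projection onto the coordinates in `S`. -/
def StableUnder (P : I → A →ₗ[k] A) (B : Submodule k A) (S : Set I) : Prop :=
  ∀ b ∈ B, ∃ c ∈ B, (∀ i ∈ S, P i c = P i b) ∧ ∀ i ∉ S, P i c = 0

namespace StableUnder

variable {P : I → A →ₗ[k] A} {B : Submodule k A} {S T : Set I}

theorem univ : StableUnder P B Set.univ := fun b hb => ⟨b, hb, by simp, by simp⟩

theorem compl (hS : StableUnder P B S) : StableUnder P B Sᶜ := by
  intro b hb
  obtain ⟨c, hc, h1, h0⟩ := hS b hb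
  refine ⟨b - c, B.sub_mem hb hc, fun i hi => ?_, fun i hi => ?_⟩
  · rw [map_sub, h0 i hi, sub_zero]
  · rw [map_sub, h1 i (not_not.mp hi), sub_self]

theorem inter (hS : StableUnder P B S) (hT : StableUnder P B T) :
    StableUnder P B (S ∩ T) := by
  intro b hb
  obtain ⟨c, hc, hc1, hc0⟩ := hS b hb
  obtain ⟨d, hd, hd1, hd0⟩ := hT c hc
  refine ⟨d, hd, fun i hi => (hd1 i hi.2).trans (hc1 i hi.1), fun i hi => ?_⟩
  by_cases hiT : i ∈ T
  · rw [hd1 i hiT, hc0 i fun hiS => hi ⟨hiS, hiT⟩]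
  · exact hd0 i hiT

theorem sInter {C : Set (Set I)} (hC : C.Finite) (h : ∀ S ∈ C, StableUnder P B S) :
    StableUnder P B (⋂₀ C) := by
  induction C, hC using Set.Finite.induction_on with
  | empty => simpa using univ
  | insert _ _ ih =>
    rw [Set.sInter_insert]
    exact (h _ (Set.mem_insert _ _)).inter (ih fun S hS => h S (Set.mem_insert_of_mem _ hS))

end StableUnder

/-- Two indices are equivalent when no coordinate set stabilizing `B` separates them. -/
def stableSetoid (P : I → A →ₗ[k] A) (B : Submodule k A) : Setoid I where
  r i j := ∀ S, StableUnder P B S → (i ∈ S ↔ j ∈ S)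
  iseqv := ⟨fun _ _ _ => Iff.rfl, fun h S hS => (h S hS).symm,
    fun h h' S hS => (h S hS).trans (h' S hS)⟩

theorem stableUnder_fiber_mk [Finite I] (P : I → A →ₗ[k] A) (B : Submodule k A)
    (q : Quotient (stableSetoid P B)) :
    StableUnder P B (Quotient.mk (stableSetoid P B) ⁻¹' {q}) := by
  induction q using Quotient.inductionOn with
  | h i =>
    convert StableUnder.sInter (Set.toFinite {S | StableUnder P B S ∧ i ∈ S})
      (fun S hS => hS.1) using 1
    ext j
    rw [Set.mem_preimage, Set.mem_singleton_iff, Quotient.eq, Set.mem_sInter]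
    constructor
    · exact fun h S hS => (h S hS.1).mpr hS.2
    · intro h S hS
      by_cases hi : i ∈ S
      · exact iff_of_true (h S ⟨hS, hi⟩) hi
      · exact iff_of_false (h Sᶜ ⟨hS.compl, hi⟩) hi

theorem map_eq_zero_of_mem_biSup {Ai : I → Submodule k A} {P : I → A →ₗ[k] A}
    (h0 : ∀ i j, i ≠ j → ∀ x ∈ Ai j, P i x = 0) {S : Set I} {x : A}
    (hx : x ∈ ⨆ i ∈ S, Ai i) {j : I} (hj : j ∉ S) : P j x = 0 := by
  have h : ⨆ i ∈ S, Ai i ≤ LinearMap.ker (P j) :=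
    iSup₂_le fun i hi y hy => h0 j i (fun e => hj (e ▸ hi)) y hy
  exact h hx

theorem mem_biSup_of_map_eq_zero [Fintype I] {Ai : I → Submodule k A} {P : I → A →ₗ[k] A}
    (hmem : ∀ i x, P i x ∈ Ai i) (hsum : ∀ x, ∑ i, P i x = x) {S : Set I} {x : A}
    (hx : ∀ i ∉ S, P i x = 0) : x ∈ ⨆ i ∈ S, Ai i := by
  rw [← hsum x]
  refine Submodule.sum_mem _ fun i _ => ?_
  by_cases hi : i ∈ S
  · exact le_iSup₂ (f := fun i (_ : i ∈ S) => Ai i) i hi (hmem i x)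
  · rw [hx i hi]
    exact Submodule.zero_mem _

/-- If a pushforward decomposition restricts to `B`, the fibers stabilize `B`. -/
theorem stableUnder_fiber {J : Type*} {Ai : I → Submodule k A} {P : I → A →ₗ[k] A}
    (h0 : ∀ i j, i ≠ j → ∀ x ∈ Ai j, P i x = 0) {B : Submodule k A} (f : I → J)
    (hf : (⨆ j : J, (⨆ i ∈ f ⁻¹' {j}, Ai i) ⊓ B) = B) (j : J) :
    StableUnder P B (f ⁻¹' {j}) := by
  intro b hb
  rw [← hf] at hb
  induction hb using Submodule.iSup_induction' with
  | mem l x hx =>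
    by_cases hl : l = j
    · subst hl
      exact ⟨x, hx.2, fun _ _ => rfl, fun i hi => map_eq_zero_of_mem_biSup h0 hx.1 hi⟩
    · refine ⟨0, B.zero_mem, fun i hi => ?_, fun i _ => map_zero _⟩
      rw [map_zero, map_eq_zero_of_mem_biSup h0 hx.1 fun h => hl (h.symm.trans hi)]
  | zero => exact ⟨0, B.zero_mem, fun _ _ => rfl, fun i _ => map_zero _⟩
  | add x y _ _ hx hy =>
    obtain ⟨c, hc, hc1, hc0⟩ := hx
    obtain ⟨d, hd, hd1, hd0⟩ := hy
    refine ⟨c + d, B.add_mem hc hd, fun i hi => ?_, fun i hi => ?_⟩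
    · rw [map_add, map_add, hc1 i hi, hd1 i hi]
    · rw [map_add, hc0 i hi, hd0 i hi, add_zero]

/-- The pushforward of an internal direct sum is independent. -/
theorem iSupIndep_biSup_fiber {J : Type*} [Fintype I] {Ai : I → Submodule k A}
    {P : I → A →ₗ[k] A} (h0 : ∀ i j, i ≠ j → ∀ x ∈ Ai j, P i x = 0)
    (hsum : ∀ x, ∑ i, P i x = x) (f : I → J) :
    iSupIndep fun j : J => ⨆ i ∈ f ⁻¹' {j}, Ai i := by
  intro j
  rw [Submodule.disjoint_def]
  intro x hx hx'
  rw [← hsum x]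
  refine Finset.sum_eq_zero fun i _ => ?_
  by_cases hi : f i = j
  · have h : (⨆ l, ⨆ (_ : l ≠ j), ⨆ i ∈ f ⁻¹' {l}, Ai i) ≤ LinearMap.ker (P i) :=
      iSup₂_le fun l hl y hy =>
        map_eq_zero_of_mem_biSup h0 hy fun h => hl (h.symm.trans hi)
    exact h hx'
  · exact map_eq_zero_of_mem_biSup h0 hx hi

/-- If all fibers stabilize `B`, the pushforward decomposition restricts to `B`. -/
theorem iSup_biSup_fiber_inf_eq {J : Type*} [Fintype I] [Finite J] {Ai : I → Submodule k A}
    {P : I → A →ₗ[k] A} (hmem : ∀ i x, P i x ∈ Ai i) (hsum : ∀ x, ∑ i, P i x = x)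
    {B : Submodule k A} (f : I → J) (hf : ∀ j, StableUnder P B (f ⁻¹' {j})) :
    (⨆ j : J, (⨆ i ∈ f ⁻¹' {j}, Ai i) ⊓ B) = B := by
  refine le_antisymm (iSup_le fun _ => inf_le_right) fun b hb => ?_
  have := Fintype.ofFinite J
  choose c hcB hc1 hc0 using fun j => hf j b hb
  have hb_eq : b = ∑ j, c j := by
    rw [← hsum b, ← hsum (∑ j, c j)]
    refine Finset.sum_congr rfl fun i _ => ?_
    rw [map_sum, Finset.sum_eq_single (f i) (fun j _ hj => hc0 j i hj.symm) (by simp)]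
    exact (hc1 (f i) i rfl).symm
  rw [hb_eq]
  exact Submodule.sum_mem _ fun j _ =>
    le_iSup (fun j => (⨆ i ∈ f ⁻¹' {j}, Ai i) ⊓ B) j
      ⟨mem_biSup_of_map_eq_zero hmem hsum (hc0 j), hcB j⟩

end Projections

/-- Let `k` be a ring, `A` a `k`-module, `B` a submodule of `A`, and
`(A_i)_{i ∈ I}` a family of submodules indexed by a finite type of which `A` is the internal
direct sum.  Then there is a surjective map `u : I → U` such that the pushforward decomposition
along `u` restricts to `B` (the intersections with `B` are independent and their supremum is
`B`), and `u` is universal: every `f : I → J` whose pushforward decomposition restricts to `B`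
factors through `u`. -/
theorem stmt17 (k : Type*) [Ring k] (A : Type*) [AddCommGroup A] [Module k A]
    (B : Submodule k A) (I : Type u) [Finite I] (Ai : I → Submodule k A)
    (hind : iSupIndep Ai) (hsup : (⨆ i, Ai i) = ⊤) :
    ∃ (U : Type u) (u : I → U), Function.Surjective u ∧
      iSupIndep (fun j : U => (⨆ i ∈ u ⁻¹' {j}, Ai i) ⊓ B) ∧
      (⨆ j : U, (⨆ i ∈ u ⁻¹' {j}, Ai i) ⊓ B) = B ∧
      ∀ (J : Type v) (f : I → J),
        (⨆ j : J, (⨆ i ∈ f ⁻¹' {j}, Ai i) ⊓ B) = B →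
        ∃ g : U → J, f = g ∘ u := by
  have := Fintype.ofFinite I
  obtain ⟨P, hmem, h0, hsum⟩ := exists_projections_of_iSupIndep Ai hind hsup
  refine ⟨Quotient (stableSetoid P B), Quotient.mk _, Quotient.mk_surjective,
    (iSupIndep_biSup_fiber h0 hsum _).mono fun _ => inf_le_left,
    iSup_biSup_fiber_inf_eq hmem hsum _ (stableUnder_fiber_mk P B), fun J f hf => ?_⟩
  exact ⟨Quotient.lift f fun i j hij =>
    ((hij _ (stableUnder_fiber h0 f hf (f i))).mp rfl).symm, rfl⟩
end

section
/- Let k be a commutative ring, R a (not necessarily commutative) reduced k-algebra, Γ a group, and (R_γ)_{γ ∈ Γ} a Γ-grading of R such that the set X = {γ ∈ Γ | R_γ ≠ 0} is finite. Then for every γ ∈ Γ with R_γ ≠ 0: γ has finite order in Γ, and R_{γ^n} ≠ 0 for every natural number n. -/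
/-- Let `k` be a commutative ring, `R` a (not necessarily commutative)
reduced `k`-algebra, `Γ` a group and `(R_γ)_{γ ∈ Γ}` a `Γ`-grading of `R` such that
`{γ | R_γ ≠ ⊥}` is finite.  Then every `γ` with `R_γ ≠ ⊥` has finite order in `Γ`, and
`R_{γ ^ n} ≠ ⊥` for every natural number `n`. -/
theorem stmt18 (k : Type*) [CommRing k] (R : Type*) [Ring R] [IsReduced R] [Algebra k R]
    (Γ : Type*) [Group Γ] (Rg : Γ → Submodule k R)
    (hind : iSupIndep Rg) (hsup : (⨆ γ, Rg γ) = ⊤)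
    (hone : (1 : R) ∈ Rg 1)
    (hmul : ∀ γ δ : Γ, ∀ x ∈ Rg γ, ∀ y ∈ Rg δ, x * y ∈ Rg (γ * δ))
    (hfin : {γ : Γ | Rg γ ≠ ⊥}.Finite) :
    ∀ γ : Γ, Rg γ ≠ ⊥ → IsOfFinOrder γ ∧ ∀ n : ℕ, Rg (γ ^ n) ≠ ⊥ := by
  intro γ hγ
  have hpow : ∀ n : ℕ, Rg (γ ^ n) ≠ ⊥ := by
    obtain ⟨x, hx, hx0⟩ := Submodule.exists_mem_ne_zero_of_ne_bot hγ
    have hmem : ∀ n : ℕ, x ^ n ∈ Rg (γ ^ n) := by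
      intro n
      induction n with
      | zero => simpa using hone
      | succ n ih =>
        rw [pow_succ, pow_succ]
        exact hmul _ _ _ ih _ hx
    have : Nontrivial R := ⟨x, 0, hx0⟩
    exact fun n => (Submodule.ne_bot_iff _).2 ⟨x ^ n, hmem n, pow_ne_zero n hx0⟩
  refine ⟨?_, hpow⟩
  by_contra h
  exact Set.infinite_of_injective_forall_mem (injective_pow_iff_not_isOfFinOrder.2 h) hpow hfin
end

section
/- Let k be a commutative ring, R a (not necessarily commutative) reduced k-algebra, Γ a group, and (R_γ)_{γ ∈ Γ} a Γ-grading of R such that the set {γ ∈ Γ | R_γ ≠ 0} is finite. Assume the identity component R_1 has no zero divisors: R is nontrivial and for all x, y ∈ R_1 with x·y = 0 one has x = 0 or y = 0. Then: (i) for all γ, δ ∈ Γ with R_γ ≠ 0 and R_δ ≠ 0 one has R_{γδ} ≠ 0; and (ii) for every γ ∈ Γ and every nonzero x ∈ R_γ, x is regular in R, i.e. for every y ∈ R, x·y = 0 implies y = 0 and y·x = 0 implies y = 0. -/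
/-- In a reduced ring, `x * y = 0` implies `y * x = 0`. -/
theorem IsReduced.mul_eq_zero_symm {R : Type*} [Ring R] [IsReduced R] {x y : R}
    (h : x * y = 0) : y * x = 0 := by
  have hsq : (y * x) ^ 2 = 0 := by
    rw [sq, mul_assoc, ← mul_assoc x y x, h, zero_mul, mul_zero]
  exact eq_zero_of_pow_eq_zero hsq

section Grading

variable {k R Γ : Type*} [CommRing k] [Ring R] [Algebra k R] [Group Γ] {Rg : Γ → Submodule k R}

theorem pow_mem_of_mul_mem (hone : (1 : R) ∈ Rg 1)
    (hmul : ∀ γ δ : Γ, ∀ x ∈ Rg γ, ∀ y ∈ Rg δ, x * y ∈ Rg (γ * δ))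
    {γ : Γ} {x : R} (hx : x ∈ Rg γ) (n : ℕ) : x ^ n ∈ Rg (γ ^ n) := by
  induction n with
  | zero => simpa using hone
  | succ n ih => simpa only [pow_succ] using hmul _ _ _ ih _ hx

variable [IsReduced R]

/-- Degrees of nonzero homogeneous elements of a reduced ring with finitely supported grading
have finite order. -/
theorem isOfFinOrder_of_mem_ne_zero (hone : (1 : R) ∈ Rg 1)
    (hmul : ∀ γ δ : Γ, ∀ x ∈ Rg γ, ∀ y ∈ Rg δ, x * y ∈ Rg (γ * δ))
    (hfin : {γ : Γ | Rg γ ≠ ⊥}.Finite) {γ : Γ} {x : R} (hx : x ∈ Rg γ) (hx0 : x ≠ 0) :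
    IsOfFinOrder γ := by
  by_contra hγ
  refine Set.infinite_of_injective_forall_mem (injective_pow_iff_not_isOfFinOrder.2 hγ)
    (fun n => ?_) hfin
  exact (Submodule.ne_bot_iff _).2 ⟨x ^ n, pow_mem_of_mul_mem hone hmul hx n,
    fun h => hx0 (eq_zero_of_pow_eq_zero h)⟩

theorem homogeneous_mul_ne_zero (hone : (1 : R) ∈ Rg 1)
    (hmul : ∀ γ δ : Γ, ∀ x ∈ Rg γ, ∀ y ∈ Rg δ, x * y ∈ Rg (γ * δ))
    (hfin : {γ : Γ | Rg γ ≠ ⊥}.Finite)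
    (hdom : ∀ x ∈ Rg 1, ∀ y ∈ Rg 1, x * y = 0 → x = 0 ∨ y = 0)
    {γ δ : Γ} {x y : R} (hx : x ∈ Rg γ) (hy : y ∈ Rg δ) (hx0 : x ≠ 0) (hy0 : y ≠ 0) :
    x * y ≠ 0 := by
  intro hxy
  obtain ⟨m, hm, hγ⟩ := (isOfFinOrder_of_mem_ne_zero hone hmul hfin hx hx0).exists_pow_eq_one
  obtain ⟨n, hn, hδ⟩ := (isOfFinOrder_of_mem_ne_zero hone hmul hfin hy hy0).exists_pow_eq_one
  have hprod : x ^ m * y ^ n = 0 := by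
    rw [← pow_sub_one_mul hm.ne' x, ← mul_pow_sub_one hn.ne' y, mul_assoc, ← mul_assoc x y, hxy,
      zero_mul, mul_zero]
  rcases hdom _ (hγ ▸ pow_mem_of_mul_mem hone hmul hx m)
    _ (hδ ▸ pow_mem_of_mul_mem hone hmul hy n) hprod with h | h
  · exact hx0 (eq_zero_of_pow_eq_zero h)
  · exact hy0 (eq_zero_of_pow_eq_zero h)

end Grading


/-- Let `k` be a commutative ring, `R` a (not necessarily commutative)
reduced `k`-algebra, `Γ` a group and `(R_γ)_{γ ∈ Γ}` a `Γ`-grading of `R` with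
`{γ | R_γ ≠ ⊥}` finite.  Assume the identity component `R_1` has no zero divisors (`R` is
nontrivial and products of nonzero elements of `R_1` are nonzero).  Then (i) for `γ, δ` with
`R_γ ≠ ⊥` and `R_δ ≠ ⊥` one has `R_{γδ} ≠ ⊥`, and (ii) every nonzero homogeneous element is
regular in `R`. -/
theorem stmt19 (k : Type*) [CommRing k] (R : Type*) [Ring R] [IsReduced R] [Algebra k R]
    (Γ : Type*) [Group Γ] (Rg : Γ → Submodule k R)
    (hind : iSupIndep Rg) (hsup : (⨆ γ, Rg γ) = ⊤)
    (hone : (1 : R) ∈ Rg 1)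
    (hmul : ∀ γ δ : Γ, ∀ x ∈ Rg γ, ∀ y ∈ Rg δ, x * y ∈ Rg (γ * δ))
    (hfin : {γ : Γ | Rg γ ≠ ⊥}.Finite)
    (hnontriv : Nontrivial R)
    (hdom : ∀ x ∈ Rg 1, ∀ y ∈ Rg 1, x * y = 0 → x = 0 ∨ y = 0) :
    (∀ γ δ : Γ, Rg γ ≠ ⊥ → Rg δ ≠ ⊥ → Rg (γ * δ) ≠ ⊥) ∧
      ∀ γ : Γ, ∀ x ∈ Rg γ, x ≠ 0 →
        ∀ y : R, (x * y = 0 → y = 0) ∧ (y * x = 0 → y = 0) := by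
  have hne {γ δ : Γ} {x y : R} (hx : x ∈ Rg γ) (hy : y ∈ Rg δ) (hx0 : x ≠ 0) (hy0 : y ≠ 0) :
      x * y ≠ 0 := homogeneous_mul_ne_zero hone hmul hfin hdom hx hy hx0 hy0
  have hleft : ∀ γ : Γ, ∀ x ∈ Rg γ, x ≠ 0 → ∀ y : R, x * y = 0 → y = 0 := by
    intro γ x hx hx0 y hxy
    have hy : y ∈ ⨆ δ, Rg δ := hsup ▸ Submodule.mem_top
    obtain ⟨f, hf, rfl⟩ := (Submodule.mem_iSup_iff_exists_finsupp _ _).1 hy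
    rw [Finsupp.sum, Finset.mul_sum] at hxy
    have hzero := (iSupIndep_iff_finsetSum_eq_zero_imp_eq_zero _).1
      (hind.comp (mul_right_injective γ)) f.support (fun δ => x * f δ)
      (fun δ _ => hmul γ δ x hx _ (hf δ)) hxy
    refine Finset.sum_eq_zero fun δ hδ => ?_
    by_contra hfδ
    exact hne hx (hf δ) hx0 hfδ (hzero δ hδ)
  refine ⟨fun γ δ hγ hδ => ?_, fun γ x hx hx0 y =>
    ⟨hleft γ x hx hx0 y, fun h => hleft γ x hx hx0 y (IsReduced.mul_eq_zero_symm h)⟩⟩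
  obtain ⟨x, hx, hx0⟩ := (Submodule.ne_bot_iff _).1 hγ
  obtain ⟨y, hy, hy0⟩ := (Submodule.ne_bot_iff _).1 hδ
  exact (Submodule.ne_bot_iff _).2 ⟨x * y, hmul γ δ x hx y hy, hne hx hy hx0 hy0⟩
end
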